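/- Let ℓ > 0 and α = 1/√2, and set τ = √((1/2)/(1/2+δ²+ε²)) and λ = ε²/(1/2+δ²+ε²), so that λ_n = τ·λ^n. Let M ≥ 1 and let x_1, …, x_N ∈ ℝ and w_1, …, w_N ∈ ℝ satisfy: (i) ∑_{m=1}^N |w_m| ≤ W for some W ≥ 0; (ii) ∑_{m=1}^N w_m·φ_n(x_m) = ∫_ℝ φ_n dμ for every n = 0, …, M−1; (iii) |x_m| ≤ 2·√M/β for all m. Let c : ℕ → ℝ satisfy ∑_{n=0}^∞ c_n² ≤ 1 and let f : ℝ → ℝ be μ-integrable with f(x) = ∑_{n=0}^∞ c_n·√(λ_n)·φ_n(x) for every x ∈ ℝ. Then |∫_ℝ f dμ − ∑_{m=1}^N w_m·f(x_m)| ≤ (1 + K·√β·W) · (√τ/(1−√λ)) · (√λ·e^{1/β²})^M, where K = 1.087. -/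

import Mathlib

open MeasureTheory ProbabilityTheory

/-- Probabilists' Hermite polynomial evaluated at a real number. -/
noncomputable def H (n : ℕ) (x : ℝ) : ℝ := Polynomial.aeval x (Polynomial.hermite n)

/-- The standard Gaussian measure on ℝ. -/
noncomputable def stdGauss : Measure ℝ := gaussianReal 0 1

/-- On `[0, ∞)`, a pair solving the ladder system of consecutive Hermite functions satisfies the
one-sided bound `b ≤ 1` as soon as `|a| ≤ 1` and the values at the origin are compatible. -/
lemma ladder_le_one {r : ℝ} (hr : 0 < r) {a b : ℝ → ℝ}
    (ha : ∀ y, HasDerivAt a (y / 2 * a y - r * b y) y)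
    (hb : ∀ y, HasDerivAt b (r * a y - y / 2 * b y) y)
    (ha1 : ∀ y, |a y| ≤ 1) (h0 : a 0 = 0 ∨ b 0 = 0) (hb0 : b 0 ≤ 1) {y : ℝ} (hy : 0 ≤ y) :
    b y ≤ 1 := by
  have hac : Continuous a := continuous_iff_continuousAt.2 fun y => (ha y).continuousAt
  have hbc : Continuous b := continuous_iff_continuousAt.2 fun y => (hb y).continuousAt
  have hac' : Continuous fun t => t / 2 * a t - r * b t := by fun_prop
  -- maximize `b` over an interval containing both `y` and the turning point `2 * r`
  obtain ⟨z, hzmem, hzmax⟩ := (isCompact_Icc (a := 0) (b := max y (2 * r))).exists_isMaxOn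
    ⟨0, le_rfl, hy.trans (le_max_left _ _)⟩ hbc.continuousOn
  refine (hzmax (show y ∈ Set.Icc 0 (max y (2 * r)) from ⟨hy, le_max_left _ _⟩)).trans ?_
  by_contra! hbz
  have hz0 : 0 < z := by
    rcases hzmem.1.eq_or_lt with h | h
    · subst h; linarith
    · exact h
  have hleft : 0 ≤ r * a z - z / 2 * b z := by
    have hev : ∀ᶠ t in nhdsWithin z (Set.Iio z), 0 ≤ slope b z t := by
      filter_upwards [Ioo_mem_nhdsLT hz0] with t ht
      rw [slope_def_field]
      have : b t ≤ b z := hzmax ⟨ht.1.le, ht.2.le.trans hzmem.2⟩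
      exact div_nonneg_of_nonpos (by linarith) (by linarith [ht.2])
    have hlim : Filter.Tendsto (slope b z) (nhdsWithin z (Set.Iio z))
        (nhds (r * a z - z / 2 * b z)) :=
      (hasDerivAt_iff_tendsto_slope.1 (hb z)).mono_left
        (nhdsWithin_mono _ fun t (ht : t < z) => ht.ne)
    exact ge_of_tendsto hlim hev
  have hz2 : z < 2 * r := by
    by_contra! h
    have h1 : r * b z ≤ r * a z := by nlinarith
    have h2 := le_of_mul_le_mul_left h1 hr
    linarith [le_abs_self (a z), ha1 z]
  have hbz' : r * a z - z / 2 * b z = 0 :=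
    IsLocalMax.hasDerivAt_eq_zero (f := b) (a := z) (by
      filter_upwards [Ioo_mem_nhds hz0 (hz2.trans_le (le_max_right y _))] with t ht
      exact hzmax ⟨ht.1.le, ht.2.le⟩) (hb z)
  have hq : ∀ t, 0 ≤ t → t ≤ z → 0 < r ^ 2 - t ^ 2 / 4 := fun t h1 h2 => by nlinarith
  have hbb : ∀ t, HasDerivAt (fun t => r * a t - t / 2 * b t)
      (-(r ^ 2 + 1 / 2 - t ^ 2 / 4) * b t) t := fun t => by
    refine (((ha t).const_mul r).fun_sub
      (((hasDerivAt_id' t).div_const 2).fun_mul (hb t))).congr_deriv ?_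
    ring
  have hT : ∀ t, r ^ 2 - t ^ 2 / 4 ≠ 0 → HasDerivAt
      (fun t => (r ^ 2 * (a t ^ 2 + b t ^ 2) - t * r * (a t * b t)) / (r ^ 2 - t ^ 2 / 4))
      (r * ((t / 2 * a t - r * b t) * (r * a t - t / 2 * b t)) / (r ^ 2 - t ^ 2 / 4) ^ 2) t := by
    intro t ht
    have hE := ((((ha t).fun_pow 2).fun_add ((hb t).fun_pow 2)).const_mul (r ^ 2)).fun_sub
      (((hasDerivAt_id' t).mul_const r).fun_mul ((ha t).fun_mul (hb t)))
    have hQ := (((hasDerivAt_id' t).fun_pow 2).div_const 4).const_sub (r ^ 2)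
    refine (hE.fun_div hQ ht).congr_deriv ?_
    congr 1
    push_cast
    ring
  have haz : z / 2 * a z - r * b z < 0 := by
    have h := hq z hz0.le le_rfl
    have : r * (z / 2 * a z - r * b z) = -(r ^ 2 - z ^ 2 / 4) * b z := by
      linear_combination z / 2 * hbz'
    nlinarith
  set A : Set ℝ := {t | t ∈ Set.Icc 0 z ∧ (0 ≤ t / 2 * a t - r * b t ∨ b t ≤ 0)}
  -- where `b` is positive, its derivative is strictly decreasing
  have hmono : ∀ p, 0 ≤ p → p < z → (∀ t ∈ Set.Ioo p z, 0 < b t) →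
      StrictAntiOn (fun t => r * a t - t / 2 * b t) (Set.Icc p z) := fun p hp0 hpz h => by
    refine strictAntiOn_of_hasDerivWithinAt_neg (convex_Icc p z) (by fun_prop)
      (fun t _ => (hbb t).hasDerivWithinAt) fun t ht => ?_
    rw [interior_Icc] at ht
    have := hq t (hp0.trans ht.1.le) ht.2.le
    have := h t ht
    nlinarith
  rcases A.eq_empty_or_nonempty with hAe | hAn
  · have hall : ∀ t ∈ Set.Icc 0 z, t / 2 * a t - r * b t < 0 ∧ 0 < b t := fun t ht => by
      by_contra! h
      refine (hAe ▸ (show t ∈ A from ⟨ht, ?_⟩) : t ∈ (∅ : Set ℝ))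
      rcases le_or_gt 0 (t / 2 * a t - r * b t) with h1 | h1
      · exact Or.inl h1
      · exact Or.inr (h h1)
    have h1 := hmono 0 le_rfl hz0 (fun t ht => (hall t ⟨ht.1.le, ht.2.le⟩).2)
      ⟨le_rfl, hz0.le⟩ ⟨hz0.le, le_rfl⟩ hz0
    have h2 := (hall 0 ⟨le_rfl, hz0.le⟩).2
    rcases h0 with h0 | h0
    · simp only [hbz', h0] at h1; norm_num at h1
    · linarith
  · have hAc : IsCompact A := by
      refine isCompact_Icc.inter_right (IsClosed.union ?_ ?_)
      · exact isClosed_le continuous_const hac'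
      · exact isClosed_le hbc continuous_const
    obtain ⟨p, ⟨hp, hpA⟩, hpmax⟩ := hAc.exists_isGreatest hAn
    have hpz : p < z := by
      rcases hp.2.eq_or_lt with h | h
      · subst h; rcases hpA with h | h <;> linarith
      · exact h
    have hright : ∀ t ∈ Set.Ioc p z, t / 2 * a t - r * b t < 0 ∧ 0 < b t := fun t ht => by
      by_contra! h
      refine absurd (hpmax (show t ∈ A from ⟨⟨hp.1.trans ht.1.le, ht.2⟩, ?_⟩)) (not_le.2 ht.1)
      rcases le_or_gt 0 (t / 2 * a t - r * b t) with h1 | h1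
      · exact Or.inl h1
      · exact Or.inr (h h1)
    have hanti := hmono p hp.1 hpz fun t ht => (hright t ⟨ht.1, ht.2.le⟩).2
    have hb'nn : ∀ t ∈ Set.Icc p z, 0 ≤ r * a t - t / 2 * b t := fun t ht => by
      have := hanti.antitoneOn ht ⟨hpz.le, le_rfl⟩ ht.2
      simpa only [hbz'] using this
    have hcl : Set.Icc p z ⊆ {t | t / 2 * a t - r * b t ≤ 0 ∧ 0 ≤ b t} := by
      rw [← closure_Ioc hpz.ne]
      refine closure_minimal (fun t ht => ⟨(hright t ht).1.le, (hright t ht).2.le⟩) ?_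
      exact (isClosed_le hac' continuous_const).inter
        (isClosed_le continuous_const hbc)
    have hpmem : p ∈ Set.Icc p z := ⟨le_rfl, hpz.le⟩
    obtain ⟨hp1, hp2⟩ := hcl hpmem
    have hpa : p / 2 * a p - r * b p = 0 := by
      rcases hpA with h | h
      · exact le_antisymm hp1 h
      · have hbp : b p = 0 := le_antisymm h hp2
        have h3 := hb'nn p hpmem
        simp only [hbp, mul_zero, sub_zero] at h3 hp1 ⊢
        have := nonneg_of_mul_nonneg_right h3 hr
        exact le_antisymm hp1 (mul_nonneg (by linarith [hp.1]) this)
    have hTanti : AntitoneOn (fun t => (r ^ 2 * (a t ^ 2 + b t ^ 2) - t * r * (a t * b t)) /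
        (r ^ 2 - t ^ 2 / 4)) (Set.Icc p z) := by
      have hq' : ∀ t ∈ Set.Icc p z, r ^ 2 - t ^ 2 / 4 ≠ 0 := fun t ht =>
        (hq t (hp.1.trans ht.1) ht.2).ne'
      refine antitoneOn_of_hasDerivWithinAt_nonpos (convex_Icc p z)
        (fun t ht => (hT t (hq' t ht)).continuousAt.continuousWithinAt)
        (fun t ht => (hT t (hq' t (interior_subset ht))).hasDerivWithinAt) fun t ht => ?_
      have ht' := interior_subset ht
      exact div_nonpos_of_nonpos_of_nonneg (mul_nonpos_of_nonneg_of_nonpos hr.le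
        (mul_nonpos_of_nonpos_of_nonneg (hcl ht').1 (hb'nn t ht'))) (sq_nonneg _)
    have hle := hTanti hpmem ⟨hpz.le, le_rfl⟩ hpz.le
    have hTz : (r ^ 2 * (a z ^ 2 + b z ^ 2) - z * r * (a z * b z)) / (r ^ 2 - z ^ 2 / 4)
        = b z ^ 2 := by
      rw [div_eq_iff (hq z hz0.le le_rfl).ne']
      linear_combination (r * a z - z / 2 * b z) * hbz'
    have hTp : (r ^ 2 * (a p ^ 2 + b p ^ 2) - p * r * (a p * b p)) / (r ^ 2 - p ^ 2 / 4)
        = a p ^ 2 := by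
      rw [div_eq_iff (hq p hp.1 hp.2).ne']
      linear_combination (p / 2 * a p - r * b p) * hpa
    simp only [hTz, hTp] at hle
    have := (sq_le_one_iff_abs_le_one _).2 (ha1 p)
    nlinarith

lemma ladder_abs_le_one {r : ℝ} (hr : 0 < r) {a b : ℝ → ℝ}
    (ha : ∀ y, HasDerivAt a (y / 2 * a y - r * b y) y)
    (hb : ∀ y, HasDerivAt b (r * a y - y / 2 * b y) y)
    (ha1 : ∀ y, |a y| ≤ 1) (h0 : a 0 = 0 ∨ b 0 = 0) (hb0 : |b 0| ≤ 1) (y : ℝ) :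
    |b y| ≤ 1 := by
  have key : ∀ {a b : ℝ → ℝ}, (∀ y, HasDerivAt a (y / 2 * a y - r * b y) y) →
      (∀ y, HasDerivAt b (r * a y - y / 2 * b y) y) → (∀ y, |a y| ≤ 1) →
      (a 0 = 0 ∨ b 0 = 0) → |b 0| ≤ 1 → ∀ {y : ℝ}, 0 ≤ y → |b y| ≤ 1 := by
    intro a b ha hb ha1 h0 hb0 y hy
    refine abs_le.2 ⟨?_, ladder_le_one hr ha hb ha1 h0 (abs_le.1 hb0).2 hy⟩
    have := ladder_le_one (a := -a) (b := -b) hr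
      (fun y => (ha y).neg.congr_deriv (by simp only [Pi.neg_apply]; ring))
      (fun y => (hb y).neg.congr_deriv (by simp only [Pi.neg_apply]; ring))
      (fun y => by simpa using ha1 y) (by simpa using h0)
      (by simp only [Pi.neg_apply]; linarith [(abs_le.1 hb0).1]) hy
    simp only [Pi.neg_apply] at this
    linarith
  rcases le_total 0 y with hy | hy
  · exact key ha hb ha1 h0 hb0 hy
  · have hneg : ∀ t : ℝ, HasDerivAt (fun t : ℝ => -t) (-1) t := fun t => (hasDerivAt_id t).neg
    have := key (a := fun t => a (-t)) (b := fun t => -b (-t))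
      (fun t => ((ha (-t)).comp t (hneg t)).congr_deriv (by ring))
      (fun t => ((hb (-t)).comp t (hneg t)).fun_neg.congr_deriv (by ring))
      (fun t => ha1 (-t)) (by simpa using h0) (by simpa using hb0) (y := -y) (by linarith)
    simpa using this

lemma H_zero (y : ℝ) : H 0 y = 1 := by simp [H]

lemma derivative_hermite_succ (n : ℕ) :
    (Polynomial.hermite (n + 1)).derivative = (n + 1 : Polynomial ℤ) * Polynomial.hermite n := by
  induction n with
  | zero => simp
  | succ n ih =>
    rw [Polynomial.hermite_succ (n + 1), ih]
    simp only [Polynomial.derivative_sub, Polynomial.derivative_mul, Polynomial.derivative_X, ih,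
      Polynomial.derivative_add, Polynomial.derivative_natCast, Polynomial.derivative_one]
    rw [Polynomial.hermite_succ n]
    push_cast
    ring

lemma hasDerivAt_H_succ (n : ℕ) (y : ℝ) : HasDerivAt (H (n + 1)) ((n + 1) * H n y) y := by
  have := (Polynomial.hermite (n + 1)).hasDerivAt_aeval y
  exact this.congr_deriv (by rw [derivative_hermite_succ]; simp [H])

lemma hasDerivAt_H (n : ℕ) (y : ℝ) : HasDerivAt (H n) (y * H n y - H (n + 1) y) y := by
  have := (Polynomial.hermite n).hasDerivAt_aeval y
  exact this.congr_deriv (by simp [H])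

/-- The Hermite functions, normalized so that `hermiteFun 0 0 = 1`. -/
noncomputable def hermiteFun (n : ℕ) (y : ℝ) : ℝ :=
  H n y * Real.exp (-(y ^ 2 / 4)) / Real.sqrt n.factorial

lemma hasDerivAt_exp_neg_sq_div_four (y : ℝ) :
    HasDerivAt (fun y => Real.exp (-(y ^ 2 / 4))) (Real.exp (-(y ^ 2 / 4)) * -(y / 2)) y := by
  refine (((hasDerivAt_id' y).fun_pow 2).div_const 4).fun_neg.exp.congr_deriv ?_
  push_cast
  ring

lemma sqrt_factorial_succ (n : ℕ) :
    Real.sqrt (n + 1).factorial = Real.sqrt (n + 1) * Real.sqrt n.factorial := by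
  rw [Nat.factorial_succ]
  push_cast
  exact Real.sqrt_mul (by positivity) _

lemma hasDerivAt_hermiteFun_succ (n : ℕ) (y : ℝ) :
    HasDerivAt (hermiteFun (n + 1))
      (Real.sqrt (n + 1) * hermiteFun n y - y / 2 * hermiteFun (n + 1) y) y := by
  have hs : Real.sqrt (n + 1 : ℝ) ≠ 0 := by positivity
  have hf : Real.sqrt (n.factorial : ℝ) ≠ 0 := by positivity
  have h2 : Real.sqrt (n + 1 : ℝ) ^ 2 = n + 1 := Real.sq_sqrt (by positivity)
  refine (((hasDerivAt_H_succ n y).fun_mul (hasDerivAt_exp_neg_sq_div_four y)).div_const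
    (Real.sqrt (n + 1).factorial)).congr_deriv ?_
  simp only [hermiteFun, sqrt_factorial_succ]
  field_simp
  rw [h2]
  ring

lemma hasDerivAt_hermiteFun (n : ℕ) (y : ℝ) :
    HasDerivAt (hermiteFun n)
      (y / 2 * hermiteFun n y - Real.sqrt (n + 1) * hermiteFun (n + 1) y) y := by
  have hs : Real.sqrt (n + 1 : ℝ) ≠ 0 := by positivity
  have hf : Real.sqrt (n.factorial : ℝ) ≠ 0 := by positivity
  refine (((hasDerivAt_H n y).fun_mul (hasDerivAt_exp_neg_sq_div_four y)).div_const
    (Real.sqrt n.factorial)).congr_deriv ?_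
  simp only [hermiteFun, sqrt_factorial_succ]
  field_simp
  ring

lemma continuous_hermiteFun (n : ℕ) : Continuous (hermiteFun n) :=
  continuous_iff_continuousAt.2 fun y => (hasDerivAt_hermiteFun n y).continuousAt

lemma hermiteFun_zero (y : ℝ) : hermiteFun 0 y = Real.exp (-(y ^ 2 / 4)) := by
  simp [hermiteFun, H_zero]

lemma sqrt_mul_hermiteFun_succ_succ_zero (n : ℕ) :
    Real.sqrt (n + 2) * hermiteFun (n + 2) 0 = -(Real.sqrt (n + 1) * hermiteFun n 0) := by
  have h1 := (hasDerivAt_hermiteFun (n + 1) 0).unique (hasDerivAt_hermiteFun_succ n 0)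
  push_cast at h1
  rw [show (n : ℝ) + 2 = n + 1 + 1 by ring]
  linear_combination -h1

lemma hermiteFun_consecutive_zero (n : ℕ) : hermiteFun n 0 = 0 ∨ hermiteFun (n + 1) 0 = 0 := by
  induction n with
  | zero => right; simp [hermiteFun, H]
  | succ n ih =>
    rcases ih with h | h
    · right
      have := sqrt_mul_hermiteFun_succ_succ_zero n
      rw [h, mul_zero, neg_zero] at this
      exact (mul_eq_zero.1 this).resolve_left (by positivity)
    · exact Or.inl h

lemma abs_hermiteFun_apply_zero_le_one (n : ℕ) : |hermiteFun n 0| ≤ 1 := by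
  induction n using Nat.twoStepInduction with
  | zero => simp [hermiteFun_zero]
  | one => simp [hermiteFun, H]
  | more n ih _ =>
    have h := congrArg abs (sqrt_mul_hermiteFun_succ_succ_zero n)
    rw [abs_neg, abs_mul, abs_mul, abs_of_nonneg (Real.sqrt_nonneg _),
      abs_of_nonneg (Real.sqrt_nonneg _)] at h
    have hs : Real.sqrt ((n : ℝ) + 1) ≤ Real.sqrt (n + 2) := Real.sqrt_le_sqrt (by linarith)
    have hp : 0 < Real.sqrt ((n : ℝ) + 2) := by positivity
    refine le_of_mul_le_mul_left (h.le.trans ?_) hp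
    exact mul_le_mul hs ih (abs_nonneg _) hp.le

/-- **Indritz's inequality**: the sharp form of Cramér's bound for Hermite functions. -/
theorem abs_hermiteFun_le_one (n : ℕ) (y : ℝ) : |hermiteFun n y| ≤ 1 := by
  induction n generalizing y with
  | zero =>
    rw [hermiteFun_zero, abs_of_pos (Real.exp_pos _)]
    exact Real.exp_le_one_iff.2 (by have := sq_nonneg y; linarith)
  | succ n ih =>
    exact ladder_abs_le_one (Real.sqrt_pos.2 (by positivity : (0 : ℝ) < n + 1))
      (hasDerivAt_hermiteFun n) (hasDerivAt_hermiteFun_succ n) ih (hermiteFun_consecutive_zero n)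
      (abs_hermiteFun_apply_zero_le_one _) y

lemma integrable_aeval_mul_exp_neg_mul_sq {R : Type*} [CommSemiring R] [Algebra R ℝ]
    (p : Polynomial R) {b : ℝ} (hb : 0 < b) :
    Integrable fun y : ℝ => Polynomial.aeval y p * Real.exp (-b * y ^ 2) := by
  induction p using Polynomial.induction_on' with
  | add p q hp hq => simpa only [map_add, add_mul] using! hp.add hq
  | monomial n c =>
    have := (integrable_rpow_mul_exp_neg_mul_sq hb
      (by linarith [n.cast_nonneg (α := ℝ)] : (-1 : ℝ) < n)).const_mul (algebraMap R ℝ c)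
    simpa only [Real.rpow_natCast, Polynomial.aeval_monomial, mul_assoc] using this

lemma integrable_hermiteFun_mul (m n : ℕ) :
    Integrable fun y => hermiteFun m y * hermiteFun n y := by
  have := (integrable_aeval_mul_exp_neg_mul_sq (Polynomial.hermite m * Polynomial.hermite n)
    (by norm_num : (0 : ℝ) < 1 / 2)).div_const
      (Real.sqrt m.factorial * Real.sqrt n.factorial)
  refine this.congr (.of_forall fun y => ?_)
  have he : Real.exp (-(1 / 2) * y ^ 2) = Real.exp (-(y ^ 2 / 4)) * Real.exp (-(y ^ 2 / 4)) := by
    rw [← Real.exp_add]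
    ring_nf
  simp only [hermiteFun, H, map_mul, he]
  ring

lemma integral_hermiteFun_sq (n : ℕ) :
    ∫ y, hermiteFun n y * hermiteFun n y = Real.sqrt (2 * Real.pi) := by
  induction n with
  | zero =>
    have he : ∀ y : ℝ, hermiteFun 0 y * hermiteFun 0 y = Real.exp (-(1 / 2) * y ^ 2) := fun y => by
      rw [hermiteFun_zero, ← Real.exp_add]
      ring_nf
    simp_rw [he, integral_gaussian]
    congr 1
    ring
  | succ n ih =>
    have hs : Real.sqrt ((n : ℝ) + 1) ≠ 0 := by positivity
    have hd : ∀ y, HasDerivAt (fun y => hermiteFun n y * hermiteFun (n + 1) y)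
        (Real.sqrt (n + 1) * (hermiteFun n y * hermiteFun n y -
          hermiteFun (n + 1) y * hermiteFun (n + 1) y)) y := fun y =>
      ((hasDerivAt_hermiteFun n y).fun_mul (hasDerivAt_hermiteFun_succ n y)).congr_deriv (by ring)
    have h0 := integral_eq_zero_of_hasDerivAt_of_integrable hd
      (((integrable_hermiteFun_mul n n).sub (integrable_hermiteFun_mul (n + 1) (n + 1))).const_mul _)
      (integrable_hermiteFun_mul n (n + 1))
    rw [integral_const_mul, integral_sub (integrable_hermiteFun_mul n n)
      (integrable_hermiteFun_mul (n + 1) (n + 1))] at h0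
    linarith [(mul_eq_zero.1 h0).resolve_left hs]

instance : IsProbabilityMeasure stdGauss := by
  unfold stdGauss
  infer_instance

/-- The Mercer eigenfunctions of the Gaussian kernel for the standard Gaussian measure. -/
noncomputable def mercerFun (β : ℝ) (n : ℕ) (x : ℝ) : ℝ :=
  Real.sqrt β * Real.exp (x ^ 2 / 4) * hermiteFun n (β * x)

lemma continuous_mercerFun (β : ℝ) (n : ℕ) : Continuous (mercerFun β n) := by
  have := continuous_hermiteFun n
  unfold mercerFun
  fun_prop

lemma abs_mercerFun_le (β : ℝ) (n : ℕ) (x : ℝ) :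
    |mercerFun β n x| ≤ Real.sqrt β * Real.exp (x ^ 2 / 4) := by
  rw [mercerFun, abs_mul, abs_of_nonneg (by positivity)]
  exact mul_le_of_le_one_right (by positivity) (abs_hermiteFun_le_one n _)

lemma gaussianPDFReal_mul_mercerFun_sq {β : ℝ} (hβ : 0 ≤ β) (n : ℕ) (x : ℝ) :
    gaussianPDFReal 0 1 x * mercerFun β n x ^ 2 =
      (Real.sqrt (2 * Real.pi))⁻¹ * β * (hermiteFun n (β * x) * hermiteFun n (β * x)) := by
  have h1 : Real.sqrt β ^ 2 = β := Real.sq_sqrt hβ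
  have h2 : Real.exp (-x ^ 2 / 2) * Real.exp (x ^ 2 / 4) ^ 2 = 1 := by
    rw [← Real.exp_nat_mul, ← Real.exp_add, ← Real.exp_zero]
    congr 1
    push_cast
    ring
  simp only [gaussianPDFReal, mercerFun, NNReal.coe_one, mul_one, sub_zero]
  linear_combination (Real.sqrt (2 * Real.pi))⁻¹ * hermiteFun n (β * x) ^ 2 *
    (Real.sqrt β ^ 2 * h2 + h1)

lemma integrable_mercerFun_sq {β : ℝ} (hβ : 0 < β) (n : ℕ) :
    Integrable (fun x => mercerFun β n x ^ 2) stdGauss := by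
  rw [stdGauss, gaussianReal_of_var_ne_zero _ one_ne_zero,
    integrable_withDensity_iff_integrable_smul' (measurable_gaussianPDF _ _)
      (ae_of_all _ fun _ => gaussianPDF_lt_top)]
  simp_rw [toReal_gaussianPDF, smul_eq_mul, gaussianPDFReal_mul_mercerFun_sq hβ.le]
  exact (((integrable_comp_mul_left_iff _ hβ.ne').2 (integrable_hermiteFun_mul n n))).const_mul _

lemma integral_mercerFun_sq {β : ℝ} (hβ : 0 < β) (n : ℕ) :
    ∫ x, mercerFun β n x ^ 2 ∂stdGauss = 1 := by
  rw [stdGauss, integral_gaussianReal_eq_integral_smul one_ne_zero]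
  simp_rw [smul_eq_mul, gaussianPDFReal_mul_mercerFun_sq hβ.le]
  rw [integral_const_mul, Measure.integral_comp_mul_left (fun y => hermiteFun n y * hermiteFun n y),
    integral_hermiteFun_sq, abs_of_pos (inv_pos.2 hβ), smul_eq_mul]
  have : Real.sqrt (2 * Real.pi) ≠ 0 := by positivity
  field_simp

lemma memLp_two_mercerFun {β : ℝ} (hβ : 0 < β) (n : ℕ) : MemLp (mercerFun β n) 2 stdGauss :=
  (memLp_two_iff_integrable_sq (continuous_mercerFun β n).aestronglyMeasurable).2
    (integrable_mercerFun_sq hβ n)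

lemma integrable_mercerFun {β : ℝ} (hβ : 0 < β) (n : ℕ) : Integrable (mercerFun β n) stdGauss :=
  (memLp_two_mercerFun hβ n).integrable one_le_two

lemma integral_norm_mercerFun_le_one {β : ℝ} (hβ : 0 < β) (n : ℕ) :
    ∫ x, ‖mercerFun β n x‖ ∂stdGauss ≤ 1 := by
  have h := variance_nonneg (fun x => ‖mercerFun β n x‖) stdGauss
  rw [variance_eq_sub (memLp_two_mercerFun hβ n).norm] at h
  have h2 : ∫ x, ((fun x => ‖mercerFun β n x‖) ^ 2) x ∂stdGauss = 1 := by
    simpa only [Pi.pow_apply, Real.norm_eq_abs, sq_abs] using integral_mercerFun_sq hβ n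
  rw [h2] at h
  nlinarith

/-- Error bound for a quadrature rule that is exact on the first `M` terms of a series whose
`n`-th term is integrated with error at most `D * r ^ n`. -/
lemma abs_integral_sub_quadrature_le {Ω ι : Type*} [MeasurableSpace Ω] {μ : Measure Ω} [Fintype ι]
    {F : ℕ → Ω → ℝ} {f : Ω → ℝ} {x : ι → Ω} {w : ι → ℝ} {M : ℕ} {D r : ℝ} (hr0 : 0 ≤ r) (hr1 : r < 1)
    (hF : ∀ n, Integrable (F n) μ) (hsum : Summable fun n => ∫ t, ‖F n t‖ ∂μ)
    (hf : ∀ t, HasSum (fun n => F n t) (f t))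
    (hexact : ∀ n < M, ∑ m, w m * F n (x m) = ∫ t, F n t ∂μ)
    (hbound : ∀ n, M ≤ n → |(∫ t, F n t ∂μ) - ∑ m, w m * F n (x m)| ≤ D * r ^ n) :
    |(∫ t, f t ∂μ) - ∑ m, w m * f (x m)| ≤ D * (r ^ M / (1 - r)) := by
  have hI : HasSum (fun n => ∫ t, F n t ∂μ) (∫ t, f t ∂μ) := by
    simpa only [(hf _).tsum_eq] using hasSum_integral_of_summable_integral_norm hF hsum
  have hE : HasSum (fun n => (∫ t, F n t ∂μ) - ∑ m, w m * F n (x m))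
      ((∫ t, f t ∂μ) - ∑ m, w m * f (x m)) :=
    hI.sub (hasSum_sum fun m _ => (hf (x m)).mul_left (w m))
  have hE' := (hasSum_nat_add_iff' M).2 hE
  rw [Finset.sum_eq_zero fun n hn => sub_eq_zero.2 (hexact n (Finset.mem_range.1 hn)).symm,
    sub_zero] at hE'
  have hG : HasSum (fun n => D * r ^ (n + M)) (D * (r ^ M / (1 - r))) := by
    simpa only [pow_add, mul_comm, div_eq_mul_inv] using
      ((hasSum_geometric_of_lt_one hr0 hr1).mul_right (r ^ M)).mul_left D
  rw [← hE'.tsum_eq, ← Real.norm_eq_abs]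
  exact tsum_of_norm_bounded hG fun n => hbound (n + M) (Nat.le_add_left _ _)

theorem stmt_16 (ℓ α : ℝ) (hℓ : 0 < ℓ) (hα : α = 1 / Real.sqrt 2)
    (ε β δ2 : ℝ)
    (hε : ε = 1 / (Real.sqrt 2 * ℓ))
    (hβ : β = (1 + (2 * ε / α) ^ 2) ^ ((1 : ℝ) / 4))
    (hδ2 : δ2 = α ^ 2 * (β ^ 2 - 1) / 2)
    (φ : ℕ → ℝ → ℝ)
    (hφ : ∀ n x, φ n x = Real.sqrt (β / (n.factorial : ℝ)) * Real.exp (-δ2 * x ^ 2) *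
      H n (Real.sqrt 2 * α * β * x))
    (τ lam : ℝ)
    (hτ : τ = Real.sqrt ((1 / 2) / (1 / 2 + δ2 + ε ^ 2)))
    (hlamdef : lam = ε ^ 2 / (1 / 2 + δ2 + ε ^ 2))
    (lamE : ℕ → ℝ) (hlamE : ∀ n, lamE n = τ * lam ^ n)
    (M N : ℕ) (hM : 1 ≤ M)
    (x w : Fin N → ℝ) (W : ℝ) (hW : 0 ≤ W)
    (hw : ∑ m, |w m| ≤ W)
    (hexact : ∀ n < M, ∑ m, w m * φ n (x m) = ∫ t, φ n t ∂stdGauss)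
    (hx : ∀ m, |x m| ≤ 2 * Real.sqrt M / β)
    (c : ℕ → ℝ) (hcsum : Summable fun n => c n ^ 2) (hc : ∑' n, c n ^ 2 ≤ 1)
    (f : ℝ → ℝ) (hfint : Integrable f stdGauss)
    (hf : ∀ t : ℝ, HasSum (fun n => c n * Real.sqrt (lamE n) * φ n t) (f t)) :
    |(∫ t, f t ∂stdGauss) - ∑ m, w m * f (x m)| ≤
      (1 + 1.087 * Real.sqrt β * W) * (Real.sqrt τ / (1 - Real.sqrt lam)) *
        (Real.sqrt lam * Real.exp (1 / β ^ 2)) ^ M := by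
  have hα2 : α ^ 2 = 1 / 2 := by
    rw [hα, div_pow, Real.sq_sqrt (by norm_num)]
    norm_num
  have hαβ : Real.sqrt 2 * α * β = β := by
    rw [hα, mul_one_div_cancel (by positivity), one_mul]
  have hα0 : 0 < α := hα ▸ by positivity
  have hε0 : 0 < ε := hε ▸ by positivity
  have hβ1 : 1 ≤ β := hβ ▸ Real.one_le_rpow (by nlinarith [sq_nonneg (2 * ε / α)]) (by norm_num)
  have hβ0 : 0 < β := by linarith
  have hδ : δ2 = (β ^ 2 - 1) / 4 := by rw [hδ2, hα2]; ring
  have hδ0 : 0 ≤ δ2 := by rw [hδ]; nlinarith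
  have hlam0 : 0 ≤ lam := hlamdef ▸ by positivity
  have hlam1 : lam < 1 := by
    rw [hlamdef, div_lt_one (by positivity)]
    linarith
  have hφ' : ∀ n, φ n = mercerFun β n := fun n => by
    funext t
    have he : Real.exp (-δ2 * t ^ 2) = Real.exp (t ^ 2 / 4) * Real.exp (-((β * t) ^ 2 / 4)) := by
      rw [← Real.exp_add, hδ]
      ring_nf
    rw [hφ, hαβ, mercerFun, hermiteFun, he, Real.sqrt_div hβ0.le]
    ring
  simp only [hφ'] at hexact hf
  have hr0 := Real.sqrt_nonneg lam
  have hr1 : Real.sqrt lam < 1 := by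
    rw [Real.sqrt_lt' one_pos]
    simpa using hlam1
  have hτ0 : 0 ≤ τ := hτ ▸ Real.sqrt_nonneg _
  have hlamE' : ∀ n, Real.sqrt (lamE n) = Real.sqrt τ * Real.sqrt lam ^ n := fun n => by
    have h : lam ^ n = (Real.sqrt lam ^ n) ^ 2 := by rw [pow_right_comm, Real.sq_sqrt hlam0]
    rw [hlamE, Real.sqrt_mul hτ0, h, Real.sqrt_sq (pow_nonneg hr0 n)]
  have hc1 : ∀ n, |c n| ≤ 1 := fun n => by
    rw [← sq_le_one_iff_abs_le_one]
    exact (hcsum.le_tsum n fun _ _ => sq_nonneg _).trans hc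
  have hcoef : ∀ n, |c n * Real.sqrt (lamE n)| ≤ Real.sqrt τ * Real.sqrt lam ^ n := fun n => by
    rw [abs_mul, abs_of_nonneg (Real.sqrt_nonneg _), hlamE']
    exact mul_le_of_le_one_left (by positivity) (hc1 n)
  have hnode : ∀ n m, |mercerFun β n (x m)| ≤ Real.sqrt β * Real.exp (M / β ^ 2) := fun n m => by
    refine (abs_mercerFun_le β n _).trans
      (mul_le_mul_of_nonneg_left (Real.exp_le_exp.2 ?_) (Real.sqrt_nonneg _))
    have h := pow_le_pow_left₀ (abs_nonneg _) (hx m) 2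
    rw [sq_abs, div_pow, mul_pow, Real.sq_sqrt M.cast_nonneg] at h
    calc x m ^ 2 / 4 ≤ 2 ^ 2 * M / β ^ 2 / 4 := by gcongr
      _ = M / β ^ 2 := by ring
  have herr : ∀ n, |(∫ t, mercerFun β n t ∂stdGauss) - ∑ m, w m * mercerFun β n (x m)| ≤
      1 + Real.sqrt β * W * Real.exp (M / β ^ 2) := fun n => by
    refine (abs_sub _ _).trans (add_le_add ?_ ?_)
    · exact (norm_integral_le_integral_norm _).trans (integral_norm_mercerFun_le_one hβ0 n)
    · calc |∑ m, w m * mercerFun β n (x m)|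
          ≤ ∑ m, |w m * mercerFun β n (x m)| := Finset.abs_sum_le_sum_abs _ _
        _ ≤ ∑ m, |w m| * (Real.sqrt β * Real.exp (M / β ^ 2)) := by
          simp_rw [abs_mul]
          gcongr
          exact hnode n _
        _ ≤ W * (Real.sqrt β * Real.exp (M / β ^ 2)) := by
          rw [← Finset.sum_mul]
          gcongr
        _ = Real.sqrt β * W * Real.exp (M / β ^ 2) := by ring
  have hsum : ∀ n, ∑ m, w m * (c n * Real.sqrt (lamE n) * mercerFun β n (x m)) =
      c n * Real.sqrt (lamE n) * ∑ m, w m * mercerFun β n (x m) := fun n => by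
    rw [Finset.mul_sum]
    exact Finset.sum_congr rfl fun m _ => by ring
  have hquad := abs_integral_sub_quadrature_le (μ := stdGauss) (x := x) (w := w) (M := M)
    (F := fun n t => c n * Real.sqrt (lamE n) * mercerFun β n t)
    (D := Real.sqrt τ * (1 + Real.sqrt β * W * Real.exp (M / β ^ 2))) hr0 hr1
    (fun n => (integrable_mercerFun hβ0 n).const_mul _) ?_ hf ?_ ?_
  · refine hquad.trans ?_
    have hexp1 : 1 ≤ Real.exp (M / β ^ 2) := Real.one_le_exp (by positivity)
    have hexp : Real.exp (1 / β ^ 2) ^ M = Real.exp (M / β ^ 2) := by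
      rw [← Real.exp_nat_mul, mul_one_div]
    have h1r : 0 < 1 - Real.sqrt lam := by linarith
    have hD : 1 + Real.sqrt β * W * Real.exp (M / β ^ 2) ≤
        (1 + 1.087 * Real.sqrt β * W) * Real.exp (M / β ^ 2) := by
      have : 0 ≤ Real.sqrt β * W * Real.exp (M / β ^ 2) := by positivity
      linarith
    calc Real.sqrt τ * (1 + Real.sqrt β * W * Real.exp (M / β ^ 2)) *
          (Real.sqrt lam ^ M / (1 - Real.sqrt lam))
        ≤ Real.sqrt τ * ((1 + 1.087 * Real.sqrt β * W) * Real.exp (M / β ^ 2)) *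
          (Real.sqrt lam ^ M / (1 - Real.sqrt lam)) := by gcongr
      _ = _ := by
        rw [mul_pow, hexp]
        ring
  · refine Summable.of_nonneg_of_le (fun n => integral_nonneg fun t => norm_nonneg _) (fun n => ?_)
      ((summable_geometric_of_lt_one hr0 hr1).mul_left (Real.sqrt τ))
    simp_rw [norm_mul (c n * Real.sqrt (lamE n)), integral_const_mul]
    exact (mul_le_of_le_one_right (norm_nonneg _) (integral_norm_mercerFun_le_one hβ0 n)).trans
      (hcoef n)
  · intro n hn
    rw [hsum, hexact n hn, integral_const_mul]
  · intro n _
    rw [hsum, integral_const_mul, ← mul_sub, abs_mul]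
    exact (mul_le_mul (hcoef n) (herr n) (abs_nonneg _) (by positivity)).trans_eq (by ring)
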